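/- arXiv:1809.06903 — 2 statements merged into one kernel-verified Lean document; each statement's English description precedes it below -/
import Mathlib

section
/- Let A, M ∈ ℂ^{n×n}, B ∈ ℂ^{n×r}, and shifts α_1, …, α_j ∈ ℂ with Re(α_i) < 0 and A + α_i M invertible; set γ_i = √(−2 Re(α_i)). Define w_0 = B and, for i = 1, …, j, let v_i ∈ ℂ^{n×r} be arbitrary, s_i = w_{i−1} − (A + α_i M) v_i, and w_i = w_{i−1} + γ_i² M v_i. Let Z_j = [γ_1 v_1, …, γ_j v_j], S_j = [s_1, …, s_j], and Γ_j = diag(γ_1 I_r, …, γ_j I_r). Then the true Lyapunov residual of the approximation X_j = Z_j Z_j* satisfies A Z_j Z_j* M* + M Z_j Z_j* A* + B B* = − S_j Γ_j Z_j* M* − M Z_j Γ_j S_j* + w_j w_j*. -/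
open Matrix
open scoped Kronecker

/-- `γ_i = √(−2 Re α_i)`. -/
noncomputable def gam (α : ℕ → ℂ) (i : ℕ) : ℝ := Real.sqrt (-2 * (α i).re)

/-- The LR-ADI low-rank factor `Z_j = [γ_1 v_1, …, γ_j v_j]`, with block columns
indexed by `Fin j × Fin r`. -/
noncomputable def Zmat (n r j : ℕ) (α : ℕ → ℂ) (v : ℕ → Matrix (Fin n) (Fin r) ℂ) :
    Matrix (Fin n) (Fin j × Fin r) ℂ :=
  Matrix.of fun p iq => (gam α ((iq.1 : ℕ) + 1) : ℂ) * v ((iq.1 : ℕ) + 1) p iq.2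

/-- The block matrix of linear system residuals `S_j = [s_1, …, s_j]`. -/
noncomputable def Smat (n r j : ℕ) (s : ℕ → Matrix (Fin n) (Fin r) ℂ) :
    Matrix (Fin n) (Fin j × Fin r) ℂ :=
  Matrix.of fun p iq => s ((iq.1 : ℕ) + 1) p iq.2

/-- `Γ_j = diag(γ_1 I_r, …, γ_j I_r)`. -/
noncomputable def Gam (r j : ℕ) (α : ℕ → ℂ) :
    Matrix (Fin j × Fin r) (Fin j × Fin r) ℂ :=
  Matrix.diagonal fun iq => (gam α ((iq.1 : ℕ) + 1) : ℂ)

lemma Zmat_mul_conjTranspose (n r j : ℕ) (α : ℕ → ℂ) (v : ℕ → Matrix (Fin n) (Fin r) ℂ) :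
    Zmat n r j α v * (Zmat n r j α v)ᴴ =
      ∑ i ∈ Finset.range j,
        (((gam α (i + 1)) ^ 2 : ℝ) : ℂ) • (v (i + 1) * (v (i + 1))ᴴ) := by
  ext p q
  rw [Finset.sum_range, Matrix.sum_apply]
  simp only [mul_apply, Fintype.sum_prod_type, Zmat, of_apply, conjTranspose_apply,
    Matrix.smul_apply, smul_eq_mul, Finset.mul_sum, star_mul', Complex.star_def, Complex.conj_ofReal]
  refine Finset.sum_congr rfl fun i _ => Finset.sum_congr rfl fun k _ => ?_
  push_cast
  ring

lemma Smat_mul_Gam_mul_conjTranspose_Zmat (n r j : ℕ) (α : ℕ → ℂ)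
    (s v : ℕ → Matrix (Fin n) (Fin r) ℂ) :
    Smat n r j s * Gam r j α * (Zmat n r j α v)ᴴ =
      ∑ i ∈ Finset.range j,
        (((gam α (i + 1)) ^ 2 : ℝ) : ℂ) • (s (i + 1) * (v (i + 1))ᴴ) := by
  ext p q
  rw [Finset.sum_range, Matrix.sum_apply, Gam, mul_apply]
  simp only [mul_diagonal]
  simp only [mul_apply, Fintype.sum_prod_type, Zmat, Smat, of_apply,
    conjTranspose_apply, Matrix.smul_apply, smul_eq_mul, Finset.mul_sum, star_mul', Complex.star_def,
    Complex.conj_ofReal]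
  refine Finset.sum_congr rfl fun i _ => Finset.sum_congr rfl fun k _ => ?_
  push_cast
  ring

lemma Zmat_mul_Gam_mul_conjTranspose_Smat (n r j : ℕ) (α : ℕ → ℂ)
    (s v : ℕ → Matrix (Fin n) (Fin r) ℂ) :
    Zmat n r j α v * Gam r j α * (Smat n r j s)ᴴ =
      ∑ i ∈ Finset.range j,
        (((gam α (i + 1)) ^ 2 : ℝ) : ℂ) • (v (i + 1) * (s (i + 1))ᴴ) := by
  have hGam : (Gam r j α)ᴴ = Gam r j α := by
    rw [Gam, diagonal_conjTranspose]
    congr 1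
    ext iq
    simp
  have h := congrArg conjTranspose (Smat_mul_Gam_mul_conjTranspose_Zmat n r j α s v)
  simpa [conjTranspose_sum, conjTranspose_mul, conjTranspose_smul, hGam, Matrix.mul_assoc] using h

/-- One inexact ADI step, with `c = -2 Re a`, seen as an update of the Lyapunov residual. -/
lemma adi_step_residual {m k : Type*} [Fintype m] [Fintype k]
    (A M : Matrix m m ℂ) (v w : Matrix m k ℂ) (a c : ℂ)
    (hc : star c = c) (hac : c = -(a + star a)) :
    c • (A * v * vᴴ * Mᴴ) + c • (M * v * vᴴ * Aᴴ) + w * wᴴ =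
      -(c • ((w - (A + a • M) * v) * vᴴ * Mᴴ)) -
        c • (M * v * (w - (A + a • M) * v)ᴴ) +
        (w + c • (M * v)) * (w + c • (M * v))ᴴ := by
  have hsa : star a = -c - a := by rw [hac]; ring
  simp only [conjTranspose_add, conjTranspose_sub, conjTranspose_mul, conjTranspose_smul, hc, hsa,
    Matrix.add_mul, Matrix.sub_mul, Matrix.mul_add, Matrix.mul_sub, Matrix.smul_mul,
    Matrix.mul_smul, Matrix.mul_assoc]
  module

/-- The true Lyapunov residual of the inexact LR-ADI approximation
`X_j = Z_j Z_jᴴ` is `−S_j Γ_j Z_jᴴ Mᴴ − M Z_j Γ_j S_jᴴ + w_j w_jᴴ`. -/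
theorem adi_true_residual (n r j : ℕ)
    (A M : Matrix (Fin n) (Fin n) ℂ) (B : Matrix (Fin n) (Fin r) ℂ)
    (α : ℕ → ℂ)
    (hα : ∀ i, 1 ≤ i → i ≤ j → (α i).re < 0)
    (hinv : ∀ i, 1 ≤ i → i ≤ j → IsUnit (A + α i • M))
    (v w s : ℕ → Matrix (Fin n) (Fin r) ℂ)
    (hw0 : w 0 = B)
    (hs : ∀ i, 1 ≤ i → i ≤ j → s i = w (i - 1) - (A + α i • M) * v i)
    (hw : ∀ i, 1 ≤ i → i ≤ j → w i = w (i - 1) + (((gam α i) ^ 2 : ℝ) : ℂ) • (M * v i)) :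
    A * Zmat n r j α v * (Zmat n r j α v)ᴴ * Mᴴ + M * Zmat n r j α v * (Zmat n r j α v)ᴴ * Aᴴ +
        B * Bᴴ =
      -(Smat n r j s * Gam r j α * (Zmat n r j α v)ᴴ * Mᴴ) -
        M * Zmat n r j α v * Gam r j α * (Smat n r j s)ᴴ + w j * (w j)ᴴ := by
  have hZ (P Q : Matrix (Fin n) (Fin n) ℂ) :
      P * Zmat n r j α v * (Zmat n r j α v)ᴴ * Q = ∑ i ∈ Finset.range j,
        (((gam α (i + 1)) ^ 2 : ℝ) : ℂ) • (P * v (i + 1) * (v (i + 1))ᴴ * Q) := by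
    rw [Matrix.mul_assoc P, Zmat_mul_conjTranspose, Finset.mul_sum, Finset.sum_mul]
    simp only [Matrix.mul_smul, Matrix.smul_mul, Matrix.mul_assoc]
  rw [hZ, hZ, Smat_mul_Gam_mul_conjTranspose_Zmat, Matrix.mul_assoc M, Matrix.mul_assoc M,
    Zmat_mul_Gam_mul_conjTranspose_Smat, Finset.sum_mul, Finset.mul_sum, ← hw0]
  have hstep (i : ℕ) (hi : i ∈ Finset.range j) :
      (((gam α (i + 1)) ^ 2 : ℝ) : ℂ) • (A * v (i + 1) * (v (i + 1))ᴴ * Mᴴ) +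
          (((gam α (i + 1)) ^ 2 : ℝ) : ℂ) • (M * v (i + 1) * (v (i + 1))ᴴ * Aᴴ) =
        -((((gam α (i + 1)) ^ 2 : ℝ) : ℂ) • (s (i + 1) * (v (i + 1))ᴴ) * Mᴴ) -
          M * ((((gam α (i + 1)) ^ 2 : ℝ) : ℂ) • (v (i + 1) * (s (i + 1))ᴴ)) +
          (w (i + 1) * (w (i + 1))ᴴ - w i * (w i)ᴴ) := by
    have hij : i + 1 ≤ j := Finset.mem_range.mp hi
    have hre := hα (i + 1) (by omega) hij
    have hgam : (((gam α (i + 1)) ^ 2 : ℝ) : ℂ) = -(α (i + 1) + star (α (i + 1))) := by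
      rw [gam, Real.sq_sqrt (by linarith), Complex.star_def, Complex.add_conj]
      push_cast
      ring
    have h := adi_step_residual A M (v (i + 1)) (w i) (α (i + 1)) _
      (Complex.conj_ofReal _) hgam
    rw [hw (i + 1) (by omega) hij, hs (i + 1) (by omega) hij, Nat.add_sub_cancel,
      Matrix.smul_mul, Matrix.mul_smul, ← Matrix.mul_assoc M, ← add_sub_assoc, ← h]
    abel
  rw [← Finset.sum_add_distrib, Finset.sum_congr rfl hstep, Finset.sum_add_distrib,
    Finset.sum_sub_distrib, Finset.sum_neg_distrib,
    Finset.sum_range_sub (fun i => w i * (w i)ᴴ)]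
  abel
end

section
/- Let A ∈ ℂ^{n×n}, B ∈ ℂ^{n}, and shifts α_1, …, α_j ∈ ℂ with Re(α_i) < 0 and A + α_i I invertible; set γ_i = √(−2 Re(α_i)) and let C_i = (A + α_i I)^{-1} (A − conj(α_i) I) denote the Cayley transforms. Define w_0 = B and, for i = 1, …, j, let v_i ∈ ℂ^{n} be arbitrary, s_i = w_{i−1} − (A + α_i I) v_i, and w_i = w_{i−1} + γ_i² v_i. Then the computed LR-ADI residual factor satisfies w_j = (∏_{k=1}^{j} C_k) B − Σ_{i=1}^{j} (∏_{k=i+1}^{j} C_k) (C_i − I) s_i, where (∏_{k=1}^{j} C_k) B is the residual factor of the exact LR-ADI iteration (i.e. the one with all s_i = 0). -/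
open Matrix

/-- The Cayley transform `C_i = (A + α_i I)⁻¹ (A − conj(α_i) I)`. -/
noncomputable def cayley {n : ℕ} (A : Matrix (Fin n) (Fin n) ℂ) (α : ℕ → ℂ) (i : ℕ) :
    Matrix (Fin n) (Fin n) ℂ :=
  (A + α i • (1 : Matrix (Fin n) (Fin n) ℂ))⁻¹ *
    (A - star (α i) • (1 : Matrix (Fin n) (Fin n) ℂ))

/-- The (ordered) product `∏_{k=a+1}^{b} C_k = C_b ⋯ C_{a+1}` (empty product is `I`). -/
noncomputable def prodFrom {n : ℕ} (C : ℕ → Matrix (Fin n) (Fin n) ℂ) (a : ℕ) :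
    ℕ → Matrix (Fin n) (Fin n) ℂ
  | 0 => 1
  | b + 1 => if b + 1 ≤ a then 1 else C (b + 1) * prodFrom C a b

theorem prodFrom_succ_of_le {n : ℕ} (C : ℕ → Matrix (Fin n) (Fin n) ℂ) {a b : ℕ} (h : a ≤ b) :
    prodFrom C a (b + 1) = C (b + 1) * prodFrom C a b := by
  rw [prodFrom, if_neg (by omega)]

theorem prodFrom_self {n : ℕ} (C : ℕ → Matrix (Fin n) (Fin n) ℂ) (a : ℕ) :
    prodFrom C a a = 1 := by
  cases a <;> simp [prodFrom]

theorem eq_prodFrom_mul_sub_sum {n m : ℕ} (C : ℕ → Matrix (Fin n) (Fin n) ℂ)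
    (w t : ℕ → Matrix (Fin n) (Fin m) ℂ) (j : ℕ)
    (h : ∀ i < j, w (i + 1) = C (i + 1) * w i - t (i + 1)) :
    w j = prodFrom C 0 j * w 0 - ∑ i ∈ Finset.Icc 1 j, prodFrom C i j * t i := by
  induction j with
  | zero => simp [prodFrom]
  | succ j ih =>
    have hsum : ∑ i ∈ Finset.Icc 1 j, prodFrom C i (j + 1) * t i =
        C (j + 1) * ∑ i ∈ Finset.Icc 1 j, prodFrom C i j * t i := by
      rw [Matrix.mul_sum]
      refine Finset.sum_congr rfl fun i hi => ?_
      rw [prodFrom_succ_of_le C (Finset.mem_Icc.1 hi).2, Matrix.mul_assoc]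
    rw [h j j.lt_succ_self, ih fun i hi => h i (hi.trans j.lt_succ_self),
      Finset.sum_Icc_succ_top (by omega), hsum, prodFrom_succ_of_le C j.zero_le,
      prodFrom_self, Matrix.one_mul, Matrix.mul_sub, Matrix.mul_assoc, sub_sub]

theorem cayley_sub_one {n : ℕ} (A : Matrix (Fin n) (Fin n) ℂ) (α : ℕ → ℂ) (i : ℕ)
    (hα : (α i).re ≤ 0) (hinv : IsUnit (A + α i • (1 : Matrix (Fin n) (Fin n) ℂ))) :
    cayley A α i - 1 = (((gam α i) ^ 2 : ℝ) : ℂ) •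
      (A + α i • (1 : Matrix (Fin n) (Fin n) ℂ))⁻¹ := by
  have hγ : (((gam α i) ^ 2 : ℝ) : ℂ) = -(α i + star (α i)) := by
    rw [gam, Real.sq_sqrt (by linarith)]
    apply Complex.ext <;> simp
    ring
  have hsplit : A - star (α i) • (1 : Matrix (Fin n) (Fin n) ℂ) =
      (A + α i • (1 : Matrix (Fin n) (Fin n) ℂ)) + (-(α i + star (α i))) • 1 := by
    module
  rw [cayley, hsplit, Matrix.mul_add, Matrix.nonsing_inv_mul _
    ((Matrix.isUnit_iff_isUnit_det _).1 hinv), hγ, Matrix.mul_smul, Matrix.mul_one,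
    add_sub_cancel_left]

/-- The computed LR-ADI residual factor is the exact residual factor
`(∏_{k=1}^{j} C_k) B` perturbed by `−Σ_{i=1}^{j} (∏_{k=i+1}^{j} C_k)(C_i − I) s_i`. -/
theorem adi_computed_residual_factor (n j : ℕ)
    (A : Matrix (Fin n) (Fin n) ℂ) (B : Matrix (Fin n) (Fin 1) ℂ)
    (α : ℕ → ℂ)
    (hα : ∀ i, 1 ≤ i → i ≤ j → (α i).re < 0)
    (hinv : ∀ i, 1 ≤ i → i ≤ j → IsUnit (A + α i • (1 : Matrix (Fin n) (Fin n) ℂ)))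
    (v w s : ℕ → Matrix (Fin n) (Fin 1) ℂ)
    (hw0 : w 0 = B)
    (hs : ∀ i, 1 ≤ i → i ≤ j →
      s i = w (i - 1) - (A + α i • (1 : Matrix (Fin n) (Fin n) ℂ)) * v i)
    (hw : ∀ i, 1 ≤ i → i ≤ j → w i = w (i - 1) + (((gam α i) ^ 2 : ℝ) : ℂ) • v i) :
    w j = prodFrom (cayley A α) 0 j * B -
      ∑ i ∈ Finset.Icc 1 j,
        prodFrom (cayley A α) i j * ((cayley A α i - 1) * s i) := by
  subst hw0
  refine eq_prodFrom_mul_sub_sum (cayley A α) w (fun i => (cayley A α i - 1) * s i) j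
    fun i hi => ?_
  have hinv' := hinv (i + 1) (by omega) hi
  have hs' := hs (i + 1) (by omega) hi
  have hw' := hw (i + 1) (by omega) hi
  rw [Nat.add_sub_cancel] at hs' hw'
  have hv : (((gam α (i + 1)) ^ 2 : ℝ) : ℂ) • v (i + 1) =
      (cayley A α (i + 1) - 1) * (w i - s (i + 1)) := by
    rw [cayley_sub_one A α (i + 1) (hα _ (by omega) hi).le hinv', hs', sub_sub_cancel,
      Matrix.smul_mul, Matrix.nonsing_inv_mul_cancel_left _ _
        ((Matrix.isUnit_iff_isUnit_det _).1 hinv')]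
  rw [hw', hv, Matrix.mul_sub, Matrix.sub_mul _ _ (w i), Matrix.one_mul]
  abel
end
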